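/- (Theorem 1, convergence of intrinsic policy iteration) Let π₀ be a positive policy and define inductively π_{k+1}(a|s) = exp( (Q^{π_k}(s,a) + η·Σ_φ K(φ|s,a)·log ρ^{π_k}(a|s,φ)) / η ) / Z^{π_k}(s), where Q^{π_k} is the unique fixed point of T^{π_k} and Z^{π_k}(s) normalizes the sum over a. Let π* be a positive policy that is optimal, i.e. V^{π*}(s) ≥ V^π(s) for every positive policy π and every s, where V^π(s) = Σ_a π(a|s)·Σ_φ K(φ|s,a)·( Q^π(s,a) + η·(log ρ^π(a|s,φ) − log π(a|s)) ). Assume in addition that for every (s,a) the limit as n → ∞ of Σ_{k=0}^{n} Σ_{s'} P(s'|s,a) · Σ_{a',φ} ( π*(a'|s')·K(φ|s',a') − π_{k+1}(a'|s')·K(φ|s',a') ) · ( η·(log ρ^{π*}(a'|s',φ) − log π*(a'|s')) + Q^{π_k}(s',a') ) exists. Then Q^{π_k}(s,a) → Q^{π*}(s,a) as k → ∞, for every (s,a) ∈ S × A. -/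

import Mathlib

open Finset

/-- The posterior ρ^π(a|s,φ) = K(φ|s,a)·π(a|s) / Σ_{a'} K(φ|s,a')·π(a'|s). -/
noncomputable def post {S A F : Type*} [Fintype A]
    (K : S → A → F → ℝ) (π : S → A → ℝ) (s : S) (a : A) (φ : F) : ℝ :=
  K s a φ * π s a / ∑ a', K s a' φ * π s a'

/-- The intrinsic Bellman operator T^π. -/
noncomputable def bellman {S A F : Type*} [Fintype S] [Fintype A] [Fintype F]
    (P : S → A → S → ℝ) (K : S → A → F → ℝ) (r : S × A → ℝ) (γ η : ℝ)
    (π : S → A → ℝ) (Q : S × A → ℝ) : S × A → ℝ :=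
  fun p => r p + γ * ∑ s', P p.1 p.2 s' * ∑ a', π s' a' * ∑ φ, K s' a' φ *
    (Q (s', a') + η * (Real.log (post K π s' a' φ) - Real.log (π s' a')))


/-- The value function V^π(s) built from the intrinsic action-value function
`Qπ` of a policy `π`. -/
noncomputable def intrinsicV {S A F : Type*} [Fintype A] [Fintype F]
    (K : S → A → F → ℝ) (η : ℝ) (π : S → A → ℝ) (Qπ : S × A → ℝ) (s : S) : ℝ :=
  ∑ a, π s a * ∑ φ, K s a φ *
    (Qπ (s, a) + η * (Real.log (post K π s a φ) - Real.log (π s a)))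

/-- Gibbs' inequality for positive weights. -/
lemma sum_mul_log_le_of_sum_le {ι : Type*} [Fintype ι] {x y : ι → ℝ}
    (hx : ∀ i, 0 < x i) (hy : ∀ i, 0 < y i) (h : ∑ i, y i ≤ ∑ i, x i) :
    ∑ i, x i * Real.log (y i) ≤ ∑ i, x i * Real.log (x i) := by
  have key : ∀ i, x i * Real.log (y i) ≤ x i * Real.log (x i) + (y i - x i) := by
    intro i
    have h1 := Real.log_le_sub_one_of_pos (div_pos (hy i) (hx i))
    rw [Real.log_div (hy i).ne' (hx i).ne'] at h1
    have h2 := mul_le_mul_of_nonneg_left h1 (hx i).le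
    have h3 : x i * (y i / x i - 1) = y i - x i := by
      have := (hx i).ne'
      field_simp
    linarith
  have hsum := Finset.sum_le_sum fun i (_ : i ∈ Finset.univ) => key i
  rw [Finset.sum_add_distrib, Finset.sum_sub_distrib] at hsum
  linarith

/-- A subsolution of a discounted linear system is bounded by its source over `1 - γ`. -/
lemma le_div_of_le_add_discounted {S : Type*} [Fintype S] {W : S → S → ℝ} {u : S → ℝ} {γ C : ℝ}
    (hW : ∀ s s', 0 ≤ W s s') (hWsum : ∀ s, ∑ s', W s s' = 1) (hγ0 : 0 ≤ γ) (hγ1 : γ < 1)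
    (h : ∀ s, u s ≤ C + γ * ∑ s', W s s' * u s') (s : S) : u s ≤ C / (1 - γ) := by
  have : Nonempty S := ⟨s⟩
  obtain ⟨m, hm⟩ := Finite.exists_max u
  refine (hm s).trans ?_
  have h1 : ∑ s', W m s' * u s' ≤ u m := by
    calc ∑ s', W m s' * u s' ≤ ∑ s', W m s' * u m :=
          Finset.sum_le_sum fun s' _ => mul_le_mul_of_nonneg_left (hm s') (hW m s')
      _ = u m := by rw [← Finset.sum_mul, hWsum, one_mul]
  have h2 := mul_le_mul_of_nonneg_left h1 hγ0
  rw [le_div_iff₀ (by linarith)]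
  linarith [h m]

section OneState

variable {S A F : Type*} [Fintype A] {K : S → A → F → ℝ} {π π' : S → A → ℝ} {s : S}

lemma sum_kernel_mul_pos [Nonempty A] (hK : ∀ s a φ, 0 < K s a φ) (hπ : ∀ s a, 0 < π s a)
    (s : S) (φ : F) : 0 < ∑ a, K s a φ * π s a :=
  Finset.sum_pos (fun a _ => mul_pos (hK s a φ) (hπ s a)) Finset.univ_nonempty

lemma post_pos [Nonempty A] (hK : ∀ s a φ, 0 < K s a φ) (hπ : ∀ s a, 0 < π s a)
    (s : S) (a : A) (φ : F) : 0 < post K π s a φ :=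
  div_pos (mul_pos (hK s a φ) (hπ s a)) (sum_kernel_mul_pos hK hπ s φ)

lemma sum_post [Nonempty A] (hK : ∀ s a φ, 0 < K s a φ) (hπ : ∀ s a, 0 < π s a)
    (s : S) (φ : F) : ∑ a, post K π s a φ = 1 := by
  unfold post
  rw [← Finset.sum_div, div_self (sum_kernel_mul_pos hK hπ s φ).ne']

lemma log_post [Nonempty A] (hK : ∀ s a φ, 0 < K s a φ) (hπ : ∀ s a, 0 < π s a)
    (s : S) (a : A) (φ : F) : Real.log (post K π s a φ) =
      Real.log (K s a φ) + Real.log (π s a) - Real.log (∑ a', K s a' φ * π s a') := by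
  unfold post
  rw [Real.log_div (mul_pos (hK s a φ) (hπ s a)).ne' (sum_kernel_mul_pos hK hπ s φ).ne',
    Real.log_mul (hK s a φ).ne' (hπ s a).ne']

variable [Fintype F]

lemma intrinsicV_eq (hKsum : ∀ s a, ∑ φ, K s a φ = 1) (η : ℝ) (π : S → A → ℝ)
    (Q : S × A → ℝ) (s : S) : intrinsicV K η π Q s =
      ∑ a, π s a * (Q (s, a) + η * ∑ φ, K s a φ * Real.log (post K π s a φ)
        - η * Real.log (π s a)) := by
  unfold intrinsicV
  refine Finset.sum_congr rfl fun a _ => ?_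
  congr 1
  calc ∑ φ, K s a φ * (Q (s, a) + η * (Real.log (post K π s a φ) - Real.log (π s a)))
      = ∑ φ, (K s a φ * (Q (s, a) - η * Real.log (π s a))
          + η * (K s a φ * Real.log (post K π s a φ))) :=
        Finset.sum_congr rfl fun φ _ => by ring
    _ = _ := by
        rw [Finset.sum_add_distrib, ← Finset.sum_mul, hKsum, ← Finset.mul_sum]
        ring

/-- The posterior of `π` is the best decoder for the actions of `π`. -/
lemma sum_log_post_le [Nonempty A] (hK : ∀ s a φ, 0 < K s a φ)
    (hπ : ∀ s a, 0 < π s a) (hπ' : ∀ s a, 0 < π' s a) (s : S) :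
    ∑ a, π s a * ∑ φ, K s a φ * Real.log (post K π' s a φ) ≤
      ∑ a, π s a * ∑ φ, K s a φ * Real.log (post K π s a φ) := by
  simp only [Finset.mul_sum]
  rw [Finset.sum_comm, Finset.sum_comm (f := fun a φ => π s a * _)]
  refine Finset.sum_le_sum fun φ _ => ?_
  have hm := sum_kernel_mul_pos hK hπ s φ
  have hw : ∀ a, π s a * K s a φ = (∑ a', K s a' φ * π s a') * post K π s a φ := by
    intro a
    unfold post
    rw [mul_div_cancel₀ _ hm.ne', mul_comm]
  simp only [← mul_assoc, hw]
  simp only [mul_assoc]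
  rw [← Finset.mul_sum, ← Finset.mul_sum]
  refine mul_le_mul_of_nonneg_left ?_ hm.le
  exact sum_mul_log_le_of_sum_le (fun a => post_pos hK hπ s a φ)
    (fun a => post_pos hK hπ' s a φ) (by rw [sum_post hK hπ, sum_post hK hπ'])

/-- The information gain of the posterior, relative to a fixed action distribution `π`, is
smallest for the posterior of `π` itself. -/
lemma sum_log_post_sub_log_le [Nonempty A] (hK : ∀ s a φ, 0 < K s a φ)
    (hKsum : ∀ s a, ∑ φ, K s a φ = 1)
    (hπ : ∀ s a, 0 < π s a) (hπsum : ∀ s, ∑ a, π s a = 1)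
    (hπ' : ∀ s a, 0 < π' s a) (hπ'sum : ∀ s, ∑ a, π' s a = 1) (s : S) :
    ∑ a, π s a * (∑ φ, K s a φ * Real.log (post K π s a φ) - Real.log (π s a)) ≤
      ∑ a, π s a * (∑ φ, K s a φ * Real.log (post K π' s a φ) - Real.log (π' s a)) := by
  have marginal_sum : ∀ p : S → A → ℝ, (∀ s, ∑ a, p s a = 1) →
      ∑ φ, ∑ a, K s a φ * p s a = 1 := by
    intro p hp
    rw [Finset.sum_comm]
    simp only [← Finset.sum_mul, hKsum, one_mul, hp]
  have expand : ∀ p : S → A → ℝ, (∀ s a, 0 < p s a) →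
      ∑ a, π s a * (∑ φ, K s a φ * Real.log (post K p s a φ) - Real.log (p s a)) =
        ∑ a, π s a * ∑ φ, K s a φ * Real.log (K s a φ) -
          ∑ φ, (∑ a, K s a φ * π s a) * Real.log (∑ a, K s a φ * p s a) := by
    intro p hp
    have h1 : ∀ a, ∑ φ, K s a φ * Real.log (post K p s a φ) - Real.log (p s a) =
        ∑ φ, K s a φ * Real.log (K s a φ) -
          ∑ φ, K s a φ * Real.log (∑ a', K s a' φ * p s a') := by
      intro a
      simp only [log_post hK hp, mul_sub, mul_add, Finset.sum_sub_distrib,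
        Finset.sum_add_distrib, ← Finset.sum_mul, hKsum]
      ring
    simp only [h1, mul_sub, Finset.sum_sub_distrib]
    congr 1
    simp only [Finset.mul_sum, Finset.sum_mul]
    rw [Finset.sum_comm]
    exact Finset.sum_congr rfl fun φ _ => Finset.sum_congr rfl fun a _ => by ring
  rw [expand π hπ, expand π' hπ']
  have := sum_mul_log_le_of_sum_le (sum_kernel_mul_pos hK hπ s) (sum_kernel_mul_pos hK hπ' s)
    (by rw [marginal_sum π hπsum, marginal_sum π' hπ'sum])
  linarith

/-- The unnormalised weight of the softmax improvement of `π`. -/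
noncomputable def softWeight (K : S → A → F → ℝ) (η : ℝ) (π : S → A → ℝ) (Q : S × A → ℝ)
    (s : S) (a : A) : ℝ :=
  Real.exp ((Q (s, a) + η * ∑ φ, K s a φ * Real.log (post K π s a φ)) / η)

lemma log_softmax [Nonempty A] {η : ℝ} (hη : 0 < η) {Q : S × A → ℝ}
    (hiter : ∀ a, π' s a = softWeight K η π Q s a / ∑ a', softWeight K η π Q s a') (a : A) :
    η * Real.log (π' s a) = Q (s, a) + η * ∑ φ, K s a φ * Real.log (post K π s a φ)
      - η * Real.log (∑ a', softWeight K η π Q s a') := by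
  have hZ : 0 < ∑ a', softWeight K η π Q s a' :=
    Finset.sum_pos (fun a _ => Real.exp_pos _) Finset.univ_nonempty
  have hw : η * Real.log (softWeight K η π Q s a) =
      Q (s, a) + η * ∑ φ, K s a φ * Real.log (post K π s a φ) := by
    rw [softWeight, Real.log_exp, mul_div_cancel₀ _ hη.ne']
  have hpos : 0 < softWeight K η π Q s a := Real.exp_pos _
  rw [hiter, Real.log_div hpos.ne' hZ.ne', mul_sub, hw]

lemma log_normalizer_le_intrinsicV [Nonempty A] {η : ℝ} (hη : 0 < η) {Q : S × A → ℝ}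
    (hK : ∀ s a φ, 0 < K s a φ) (hKsum : ∀ s a, ∑ φ, K s a φ = 1)
    (hπ : ∀ s a, 0 < π s a) (hπ' : ∀ s a, 0 < π' s a) (hπ'sum : ∀ s, ∑ a, π' s a = 1)
    (hiter : ∀ a, π' s a = softWeight K η π Q s a / ∑ a', softWeight K η π Q s a') :
    η * Real.log (∑ a', softWeight K η π Q s a') ≤ intrinsicV K η π' Q s := by
  have h := mul_le_mul_of_nonneg_left (sum_log_post_le hK hπ' hπ s) hη.le
  have e : intrinsicV K η π' Q s = ∑ a, (π' s a * (η * Real.log (∑ a', softWeight K η π Q s a'))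
      + η * (π' s a * ∑ φ, K s a φ * Real.log (post K π' s a φ))
      - η * (π' s a * ∑ φ, K s a φ * Real.log (post K π s a φ))) := by
    rw [intrinsicV_eq hKsum]
    refine Finset.sum_congr rfl fun a _ => ?_
    rw [log_softmax hη hiter]
    ring
  rw [e, Finset.sum_sub_distrib, Finset.sum_add_distrib, ← Finset.sum_mul, hπ'sum,
    ← Finset.mul_sum, ← Finset.mul_sum]
  linarith

/-- Three-point inequality for softmax improvement: the advantage of any policy `x` over the log
normalizer is bounded by the decrease of the relative entropy to `x`. -/
lemma intrinsicV_sub_log_normalizer_le [Nonempty A] {η : ℝ} (hη : 0 < η) {Q : S × A → ℝ}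
    {x : S → A → ℝ} (hK : ∀ s a φ, 0 < K s a φ) (hKsum : ∀ s a, ∑ φ, K s a φ = 1)
    (hπ : ∀ s a, 0 < π s a) (hπsum : ∀ s, ∑ a, π s a = 1)
    (hx : ∀ s a, 0 < x s a) (hxsum : ∀ s, ∑ a, x s a = 1)
    (hiter : ∀ a, π' s a = softWeight K η π Q s a / ∑ a', softWeight K η π Q s a') :
    intrinsicV K η x Q s - η * Real.log (∑ a', softWeight K η π Q s a') ≤
      η * (∑ a, x s a * Real.log (π' s a) - ∑ a, x s a * Real.log (π s a)) := by
  have h := mul_le_mul_of_nonneg_left (sum_log_post_sub_log_le hK hKsum hx hxsum hπ hπsum s) hη.le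
  have e1 : intrinsicV K η x Q s = ∑ a, x s a * Q (s, a) + η * ∑ a, x s a *
      (∑ φ, K s a φ * Real.log (post K x s a φ) - Real.log (x s a)) := by
    rw [intrinsicV_eq hKsum, Finset.mul_sum, ← Finset.sum_add_distrib]
    exact Finset.sum_congr rfl fun a _ => by ring
  have e2 : η * (∑ a, x s a * Real.log (π' s a) - ∑ a, x s a * Real.log (π s a)) =
      ∑ a, x s a * Q (s, a) + η * ∑ a, x s a *
        (∑ φ, K s a φ * Real.log (post K π s a φ) - Real.log (π s a))
      - ∑ a, x s a * (η * Real.log (∑ a', softWeight K η π Q s a')) := by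
    rw [← Finset.sum_sub_distrib, Finset.mul_sum, Finset.mul_sum, ← Finset.sum_add_distrib,
      ← Finset.sum_sub_distrib]
    refine Finset.sum_congr rfl fun a _ => ?_
    linear_combination x s a * log_softmax hη hiter a
  rw [← Finset.sum_mul, hxsum] at e2
  linarith

lemma intrinsicV_le_log_normalizer [Nonempty A] {η : ℝ} (hη : 0 < η) {Q : S × A → ℝ}
    (hK : ∀ s a φ, 0 < K s a φ) (hKsum : ∀ s a, ∑ φ, K s a φ = 1)
    (hπ : ∀ s a, 0 < π s a) (hπsum : ∀ s, ∑ a, π s a = 1)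
    (hπ' : ∀ s a, 0 < π' s a) (hπ'sum : ∀ s, ∑ a, π' s a = 1)
    (hiter : ∀ a, π' s a = softWeight K η π Q s a / ∑ a', softWeight K η π Q s a') :
    intrinsicV K η π Q s ≤ η * Real.log (∑ a', softWeight K η π Q s a') := by
  have h1 := intrinsicV_sub_log_normalizer_le hη hK hKsum hπ hπsum hπ hπsum hiter
  have h2 := sum_mul_log_le_of_sum_le (hπ s) (hπ' s) (by rw [hπsum, hπ'sum])
  have h3 := mul_le_mul_of_nonneg_left (sub_nonpos.2 h2) hη.le
  linarith

lemma intrinsicV_sub (hKsum : ∀ s a, ∑ φ, K s a φ = 1) (η : ℝ) (π : S → A → ℝ)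
    (Q Q' : S × A → ℝ) (s : S) : intrinsicV K η π Q s - intrinsicV K η π Q' s =
      ∑ a, π s a * (Q (s, a) - Q' (s, a)) := by
  rw [intrinsicV_eq hKsum, intrinsicV_eq hKsum, ← Finset.sum_sub_distrib]
  exact Finset.sum_congr rfl fun a _ => by ring

lemma sum_policy_mul_sum_transition [Fintype S] (P : S → A → S → ℝ) (π : S → A → ℝ)
    (u : S → ℝ) (s : S) : ∑ a, π s a * ∑ s', P s a s' * u s' =
      ∑ s', (∑ a, π s a * P s a s') * u s' := by
  simp only [Finset.mul_sum, Finset.sum_mul]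
  rw [Finset.sum_comm]
  exact Finset.sum_congr rfl fun s' _ => Finset.sum_congr rfl fun a _ => by ring

lemma sum_policy_transition [Fintype S] {P : S → A → S → ℝ} (hP : ∀ s a, ∑ s', P s a s' = 1)
    (hπsum : ∀ s, ∑ a, π s a = 1) (s : S) : ∑ s', ∑ a, π s a * P s a s' = 1 := by
  rw [Finset.sum_comm]
  simp only [← Finset.mul_sum, hP, mul_one, hπsum]

end OneState

/-- Theorem 1 (convergence of intrinsic policy iteration): repeatedly applying
policy evaluation (fixed point of T^{π_k}) and softmax improvement produces
action-value functions converging to the optimal one. -/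
theorem intrinsic_policy_iteration_converges
    {S A F : Type*} [Fintype S] [Fintype A] [Fintype F]
    [Nonempty S] [Nonempty A] [Nonempty F]
    (P : S → A → S → ℝ) (hPpos : ∀ s a s', 0 ≤ P s a s')
    (hPsum : ∀ s a, ∑ s', P s a s' = 1)
    (K : S → A → F → ℝ) (hKpos : ∀ s a φ, 0 < K s a φ)
    (hKsum : ∀ s a, ∑ φ, K s a φ = 1)
    (r : S × A → ℝ) (γ : ℝ) (hγ0 : 0 ≤ γ) (hγ1 : γ < 1)
    (η : ℝ) (hη : 0 < η)
    -- `Qof π` is the intrinsic action-value function of the policy `π`,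
    -- i.e. the unique fixed point of T^π, for every positive policy π:
    (Qof : (S → A → ℝ) → (S × A → ℝ))
    (hQof : ∀ π : S → A → ℝ, (∀ s a, 0 < π s a) → (∀ s, ∑ a, π s a = 1) →
      bellman P K r γ η π (Qof π) = Qof π)
    -- the policy iteration sequence:
    (π : ℕ → S → A → ℝ)
    (hπpos : ∀ k s a, 0 < π k s a) (hπsum : ∀ k s, ∑ a, π k s a = 1)
    (hπiter : ∀ k s a, π (k + 1) s a =
      Real.exp ((Qof (π k) (s, a) +
        η * ∑ φ, K s a φ * Real.log (post K (π k) s a φ)) / η) /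
      ∑ a', Real.exp ((Qof (π k) (s, a') +
        η * ∑ φ, K s a' φ * Real.log (post K (π k) s a' φ)) / η))
    -- π* is an optimal positive policy:
    (πs : S → A → ℝ)
    (hπspos : ∀ s a, 0 < πs s a) (hπssum : ∀ s, ∑ a, πs s a = 1)
    (hopt : ∀ π' : S → A → ℝ, (∀ s a, 0 < π' s a) → (∀ s, ∑ a, π' s a = 1) →
      ∀ s, intrinsicV K η π' (Qof π') s ≤ intrinsicV K η πs (Qof πs) s)
    -- Assumption 3: the partial sums below converge:
    (hlim : ∀ s a, ∃ L : ℝ,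
      Filter.Tendsto (fun n => ∑ k ∈ Finset.range (n + 1),
        ∑ s', P s a s' * ∑ a', ∑ φ,
          (πs s' a' * K s' a' φ - π (k + 1) s' a' * K s' a' φ) *
          (η * (Real.log (post K πs s' a' φ) - Real.log (πs s' a')) +
            Qof (π k) (s', a')))
        Filter.atTop (nhds L)) :
    ∀ s a, Filter.Tendsto (fun k => Qof (π k) (s, a))
      Filter.atTop (nhds (Qof πs (s, a))) := by
  set V : (S → A → ℝ) → S → ℝ := fun p => intrinsicV K η p (Qof p) with hV
  have hQ : ∀ p : S → A → ℝ, (∀ s a, 0 < p s a) → (∀ s, ∑ a, p s a = 1) → ∀ s a,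
      Qof p (s, a) = r (s, a) + γ * ∑ s', P s a s' * V p s' :=
    fun p hp hps s a => (congrFun (hQof p hp hps) (s, a)).symm
  have hdiff : ∀ x p q : S → A → ℝ, (∀ s a, 0 < p s a) → (∀ s, ∑ a, p s a = 1) →
      (∀ s a, 0 < q s a) → (∀ s, ∑ a, q s a = 1) → ∀ s,
      intrinsicV K η x (Qof p) s - intrinsicV K η x (Qof q) s =
        γ * ∑ s', (∑ a, x s a * P s a s') * (V p s' - V q s') := by
    intro x p q hp hps hq hqs s
    rw [intrinsicV_sub hKsum, ← sum_policy_mul_sum_transition, Finset.mul_sum]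
    refine Finset.sum_congr rfl fun a _ => ?_
    rw [hQ p hp hps, hQ q hq hqs]
    simp only [mul_sub, Finset.sum_sub_distrib]
    ring
  have hWnonneg : ∀ x : S → A → ℝ, (∀ s a, 0 < x s a) → ∀ s s',
      0 ≤ ∑ a, x s a * P s a s' := fun x hx s s' =>
    Finset.sum_nonneg fun a _ => mul_nonneg (hx s a).le (hPpos s a s')
  have hiter : ∀ k s a, π (k + 1) s a = softWeight K η (π k) (Qof (π k)) s a /
      ∑ a', softWeight K η (π k) (Qof (π k)) s a' := hπiter
  have hmono : ∀ k s, V (π k) s ≤ V (π (k + 1)) s := by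
    intro k s
    have h := le_div_of_le_add_discounted (u := fun s => V (π k) s - V (π (k + 1)) s) (C := 0)
      (hWnonneg _ (hπpos (k + 1))) (sum_policy_transition hPsum (hπsum (k + 1))) hγ0 hγ1
      (fun s => by
        have h1 := intrinsicV_le_log_normalizer hη hKpos hKsum (hπpos k) (hπsum k)
          (hπpos (k + 1)) (hπsum (k + 1)) (hiter k s)
        have h2 := log_normalizer_le_intrinsicV hη hKpos hKsum (hπpos k)
          (hπpos (k + 1)) (hπsum (k + 1)) (hiter k s)
        have h3 := hdiff (π (k + 1)) (π k) (π (k + 1)) (hπpos k) (hπsum k)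
          (hπpos (k + 1)) (hπsum (k + 1)) s
        simp only [hV] at h3 ⊢
        linarith) s
    rw [zero_div] at h
    linarith
  have hstep : ∀ k s, (V πs s - V (π (k + 1)) s)
      ≤ γ * ∑ s', (∑ a, πs s a * P s a s') * (V πs s' - V (π k) s') +
        η * (∑ a, πs s a * Real.log (π (k + 1) s a) - ∑ a, πs s a * Real.log (π k s a)) := by
    intro k s
    have h1 := intrinsicV_sub_log_normalizer_le hη hKpos hKsum (hπpos k) (hπsum k)
      hπspos hπssum (hiter k s)
    have h2 := log_normalizer_le_intrinsicV hη hKpos hKsum (hπpos k)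
      (hπpos (k + 1)) (hπsum (k + 1)) (hiter k s)
    have h3 := hdiff (π (k + 1)) (π (k + 1)) (π k) (hπpos (k + 1)) (hπsum (k + 1))
      (hπpos k) (hπsum k) s
    have h4 := hdiff πs πs (π k) hπspos hπssum (hπpos k) (hπsum k) s
    have h5 : 0 ≤ γ * ∑ s', (∑ a, π (k + 1) s a * P s a s') *
        (V (π (k + 1)) s' - V (π k) s') :=
      mul_nonneg hγ0 (Finset.sum_nonneg fun s' _ =>
        mul_nonneg (hWnonneg _ (hπpos (k + 1)) s s') (sub_nonneg.2 (hmono k s')))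
    simp only [hV] at h3 h4 h5 ⊢
    linarith
  have hgap : ∀ k s, 0 ≤ V πs s - V (π k) s := fun k s =>
    sub_nonneg.2 (hopt (π k) (hπpos k) (hπsum k) s)
  have hsum : ∀ n s, ∑ k ∈ Finset.range n, (V πs s - V (π (k + 1)) s)
      ≤ γ * ∑ s', (∑ a, πs s a * P s a s') *
          ∑ k ∈ Finset.range n, (V πs s' - V (π k) s') +
        η * (∑ a, πs s a * Real.log (π n s a) - ∑ a, πs s a * Real.log (π 0 s a)) := by
    intro n s
    induction n with
    | zero => simp
    | succ n ih =>
      simp only [Finset.sum_range_succ, mul_add, Finset.sum_add_distrib]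
      have := hstep n s
      linarith
  obtain ⟨C, hC⟩ : ∃ C, ∀ s, V πs s - V (π 0) s + η * (∑ a, πs s a * Real.log (πs s a) -
      ∑ a, πs s a * Real.log (π 0 s a)) ≤ C := by
    obtain ⟨m, hm⟩ := Finite.exists_max fun s => V πs s - V (π 0) s +
      η * (∑ a, πs s a * Real.log (πs s a) - ∑ a, πs s a * Real.log (π 0 s a))
    exact ⟨_, hm⟩
  have hbound : ∀ s n, ∑ k ∈ Finset.range n, (V πs s - V (π k) s) ≤ C / (1 - γ) := by
    intro s n
    refine le_div_of_le_add_discounted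
      (u := fun s => ∑ k ∈ Finset.range n, (V πs s - V (π k) s))
      (hWnonneg _ hπspos) (sum_policy_transition hPsum hπssum) hγ0 hγ1 (fun s => ?_) s
    have h1 := Finset.sum_range_succ' (fun k => V πs s - V (π k) s) n
    rw [Finset.sum_range_succ] at h1
    have h2 := mul_le_mul_of_nonneg_left (sum_mul_log_le_of_sum_le (hπspos s) (hπpos n s)
      (by rw [hπsum, hπssum])) hη.le
    have h3 := hC s
    have h4 := hsum n s
    have h5 := hgap n s
    rw [mul_sub] at h3 h4
    linarith
  have hVlim : ∀ s, Filter.Tendsto (fun k => V (π k) s) Filter.atTop (nhds (V πs s)) := by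
    intro s
    have h := (summable_of_sum_range_le (fun k => hgap k s) (hbound s)).tendsto_atTop_zero
    simpa using h.const_sub (V πs s)
  intro s a
  simp only [hQ _ (hπpos _) (hπsum _), hQ πs hπspos hπssum]
  exact ((tendsto_finsetSum _ fun s' _ => (hVlim s').const_mul _).const_mul γ).const_add _
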